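/- arXiv:1210.5722 — 10 statements merged into one kernel-verified Lean document; each statement's English description precedes it below -/
import Mathlib

section
/- Let G be a group with identity element 1 and let m ∈ G. In the unitization R_m(1), writing 𝔢 = [1] and 𝔪̄ = [m⁻¹] (regarded as elements of the ℤ[G]-summand), one has (𝔢 − 1)·(𝔪̄ − 1) = 1 and (𝔪̄ − 1)·(𝔢 − 1) = 1; in particular 𝔢 − 1 is a unit of R_m(1) with inverse 𝔪̄ − 1. -/
noncomputable section

/-- The underlying additive group of the group ring `ℤ[G]`, equipped below with the
*twisted* (non-unital) product `u *̃ v = u · ([1] + [m]) · v`. -/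
@[ext]
structure Rm (G : Type) [Group G] (m : G) : Type where
  val : MonoidAlgebra ℤ G

namespace Rm

variable {G : Type} [Group G] {m : G}

/-- The twisting element `[1] + [m]` of the group ring `ℤ[G]`. -/
def tw (G : Type) [Group G] (m : G) : MonoidAlgebra ℤ G :=
  MonoidAlgebra.single 1 1 + MonoidAlgebra.single m 1

theorem val_injective : Function.Injective (val : Rm G m → MonoidAlgebra ℤ G) := by
  intro a b h; cases a; cases b; cases h; rfl

instance : Zero (Rm G m) := ⟨⟨0⟩⟩
instance : Add (Rm G m) := ⟨fun a b => ⟨a.val + b.val⟩⟩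
instance : Neg (Rm G m) := ⟨fun a => ⟨-a.val⟩⟩
instance : Sub (Rm G m) := ⟨fun a b => ⟨a.val - b.val⟩⟩
instance : SMul ℕ (Rm G m) := ⟨fun n a => ⟨n • a.val⟩⟩
instance : SMul ℤ (Rm G m) := ⟨fun n a => ⟨n • a.val⟩⟩

/-- The twisted product `u *̃ v = u · ([1] + [m]) · v`. -/
instance : Mul (Rm G m) := ⟨fun a b => ⟨a.val * tw G m * b.val⟩⟩

@[simp] theorem zero_val : (0 : Rm G m).val = 0 := rfl
@[simp] theorem add_val (a b : Rm G m) : (a + b).val = a.val + b.val := rfl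
@[simp] theorem neg_val (a : Rm G m) : (-a).val = -a.val := rfl
@[simp] theorem sub_val (a b : Rm G m) : (a - b).val = a.val - b.val := rfl
@[simp] theorem nsmul_val (n : ℕ) (a : Rm G m) : (n • a).val = n • a.val := rfl
@[simp] theorem zsmul_val (n : ℤ) (a : Rm G m) : (n • a).val = n • a.val := rfl
@[simp] theorem mul_val (a b : Rm G m) : (a * b).val = a.val * tw G m * b.val := rfl

instance : AddCommGroup (Rm G m) :=
  val_injective.addCommGroup val rfl (fun _ _ => rfl) (fun _ => rfl) (fun _ _ => rfl)
    (fun _ _ => rfl) (fun _ _ => rfl)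

instance : NonUnitalRing (Rm G m) :=
  { (inferInstance : AddCommGroup (Rm G m)), (inferInstance : Mul (Rm G m)) with
    left_distrib := fun a b c => val_injective (by simp [mul_add])
    right_distrib := fun a b c => val_injective (by simp [add_mul])
    zero_mul := fun a => val_injective (by simp)
    mul_zero := fun a => val_injective (by simp)
    mul_assoc := fun a b c => val_injective (by simp [mul_assoc]) }

instance : Module ℤ (Rm G m) :=
  Function.Injective.module ℤ
    { toFun := val, map_zero' := rfl, map_add' := fun _ _ => rfl }
    val_injective (fun _ _ => rfl)

instance : SMulCommClass ℤ (Rm G m) (Rm G m) :=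
  ⟨fun z a b => val_injective (by simp [mul_smul_comm])⟩

instance : IsScalarTower ℤ (Rm G m) (Rm G m) :=
  ⟨fun z a b => val_injective (by simp [smul_mul_assoc])⟩

end Rm

/-- The basis element `[x]` of `ℤ[G]`, viewed inside the twisted ring `R_m`. -/
def el {G : Type} [Group G] (m x : G) : Rm G m := ⟨MonoidAlgebra.single x 1⟩

/-- The basis element `[x]` of `ℤ[G]`, viewed inside the unitization `R_m(1) = ℤ ⊕ R_m`. -/
def br {G : Type} [Group G] (m x : G) : Unitization ℤ (Rm G m) :=
  Unitization.inr (el m x)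

theorem el_one_mul_el_inv {G : Type} [Group G] (m : G) :
    el m 1 * el m m⁻¹ = el m 1 + el m m⁻¹ :=
  Rm.val_injective (by
    simp [el, Rm.tw, add_mul, mul_add, MonoidAlgebra.single_mul_single, add_comm])

theorem el_inv_mul_el_one {G : Type} [Group G] (m : G) :
    el m m⁻¹ * el m 1 = el m 1 + el m m⁻¹ :=
  Rm.val_injective (by
    simp [el, Rm.tw, add_mul, mul_add, MonoidAlgebra.single_mul_single, add_comm])

theorem br_one_mul_br_inv {G : Type} [Group G] (m : G) :
    br m 1 * br m m⁻¹ = br m 1 + br m m⁻¹ := by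
  simp only [br, ← Unitization.inr_mul, ← Unitization.inr_add, el_one_mul_el_inv]

theorem br_inv_mul_br_one {G : Type} [Group G] (m : G) :
    br m m⁻¹ * br m 1 = br m 1 + br m m⁻¹ := by
  simp only [br, ← Unitization.inr_mul, ← Unitization.inr_add, el_inv_mul_el_one]

/-- In the unitization `R_m(1)`, with `𝔢 = [1]` and `𝔪̄ = [m⁻¹]`, one has
`(𝔢 - 1)(𝔪̄ - 1) = 1` and `(𝔪̄ - 1)(𝔢 - 1) = 1`; in particular `𝔢 - 1` is a unit with
inverse `𝔪̄ - 1`. -/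
theorem e_sub_one_mul_mbar_sub_one (G : Type) [Group G] (m : G) :
    (br m 1 - 1) * (br m m⁻¹ - 1) = 1 ∧ (br m m⁻¹ - 1) * (br m 1 - 1) = 1 ∧
      IsUnit (br m 1 - 1) := by
  have h₁ : (br m 1 - 1) * (br m m⁻¹ - 1) = 1 := by
    rw [sub_mul, mul_sub, br_one_mul_br_inv, one_mul, mul_one]
    abel
  have h₂ : (br m m⁻¹ - 1) * (br m 1 - 1) = 1 := by
    rw [sub_mul, mul_sub, br_inv_mul_br_one, one_mul, mul_one]
    abel
  exact ⟨h₁, h₂, ⟨⟨_, _, h₁, h₂⟩, rfl⟩⟩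
end
end

section
/- Let G be a group with identity element 1, m ∈ G, and L a subgroup of G. Let Q denote the quotient of the unitization R_m(1) by the two-sided ideal generated by the sets {[lx] − [x] : x ∈ G, l ∈ L}, {[xl] − [x] : x ∈ G, l ∈ L} and {[mx] − [xm] : x ∈ G}, with quotient map π : R_m(1) → Q. Then there exists a ring homomorphism φ from the Laurent polynomial ring ℤ[μ^{±1}] to Q with φ(μ) = π(𝔢 − 1) and φ(μ⁻¹) = π(𝔪̄ − 1), and the image of φ lies in the center of Q; in particular Q is an algebra over ℤ[μ^{±1}]. -/
noncomputable section

/-- The generators of the ideal defining the string algebra presentation: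
`[lx] - [x]`, `[xl] - [x]` (for `l ∈ L`), and `[mx] - [xm]`, inside `R_m(1)`. -/
def stringRelSet (G : Type) [Group G] (m : G) (L : Subgroup G) :
    Set (Unitization ℤ (Rm G m)) :=
  {z | ∃ x : G, ∃ l ∈ L, z = br m (l * x) - br m x} ∪
    {z | ∃ x : G, ∃ l ∈ L, z = br m (x * l) - br m x} ∪
    {z | ∃ x : G, z = br m (m * x) - br m (x * m)}

/-- The quotient `Q` of `R_m(1)` by the two-sided ideal generated by `stringRelSet`. -/
abbrev StringQuot (G : Type) [Group G] (m : G) (L : Subgroup G) :=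
  (TwoSidedIdeal.span (stringRelSet G m L)).ringCon.Quotient

/-- The quotient map `π : R_m(1) → Q`. -/
def stringQuotMap (G : Type) [Group G] (m : G) (L : Subgroup G) :
    Unitization ℤ (Rm G m) →+* StringQuot G m L :=
  RingCon.mk' _

theorem exists_laurentPolynomial_hom_commute {R : Type*} [Ring R] (u : Rˣ)
    (hu : ∀ q : R, Commute (u : R) q) :
    ∃ φ : LaurentPolynomial ℤ →+* R,
      φ (LaurentPolynomial.T 1) = u ∧ φ (LaurentPolynomial.T (-1)) = ((u⁻¹ : Rˣ) : R) ∧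
      ∀ (p : LaurentPolynomial ℤ) (q : R), Commute (φ p) q := by
  let φ : LaurentPolynomial ℤ →ₐ[ℤ] R :=
    AddMonoidAlgebra.lift ℤ R ℤ ((Units.coeHom R).comp (zpowersHom Rˣ u))
  have hT (n : ℤ) : φ (LaurentPolynomial.T n) = ((u ^ n : Rˣ) : R) :=
    (AddMonoidAlgebra.lift_single ..).trans (one_smul ℤ _)
  have hpow (n : ℤ) (q : R) : Commute ((u ^ n : Rˣ) : R) q := by
    cases n with
    | ofNat k => simpa using (hu q).pow_left k
    | negSucc k =>
      rw [zpow_negSucc, Commute.units_inv_left_iff, Units.val_pow_eq_pow_val]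
      exact (hu q).pow_left _
  refine ⟨φ, by simpa using hT 1, by simpa using hT (-1), fun p q => ?_⟩
  induction p using LaurentPolynomial.induction_on' with
  | add p₁ p₂ h₁ h₂ => simpa using h₁.add_left h₂
  | C_mul_T n a =>
    have hC : φ (LaurentPolynomial.C a) = (a : R) := by
      simp
    have h : Commute (φ (LaurentPolynomial.C a * LaurentPolynomial.T n)) q := by
      rw [map_mul, hC, hT]
      exact (Int.cast_commute a q).mul_left (hpow n q)
    exact h

theorem br_mul_br {G : Type} [Group G] (m x y : G) :
    br m x * br m y = br m (x * y) + br m (x * m * y) := by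
  rw [br, br, ← Unitization.inr_mul, br, br, ← Unitization.inr_add]
  congr 1
  apply Rm.val_injective
  simp [el, Rm.tw, mul_add, add_mul]

theorem Rm.induction {G : Type} [Group G] {m : G} {P : Rm G m → Prop} (u : Rm G m)
    (h_zero : P 0) (h_el : ∀ x, P (el m x)) (h_add : ∀ a b, P a → P b → P (a + b))
    (h_zsmul : ∀ (n : ℤ) a, P a → P (n • a)) : P u := by
  obtain ⟨u⟩ := u
  induction u using MonoidAlgebra.induction_linear with
  | zero => exact h_zero
  | add f g hf hg => exact h_add ⟨f⟩ ⟨g⟩ hf hg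
  | single x n =>
    have h : (⟨MonoidAlgebra.single x n⟩ : Rm G m) = n • el m x :=
      Rm.val_injective (by simp [el])
    exact h ▸ h_zsmul n _ (h_el x)

theorem stringQuotMap_surjective (G : Type) [Group G] (m : G) (L : Subgroup G) :
    Function.Surjective (stringQuotMap G m L) :=
  RingCon.mk'_surjective _

theorem stringQuotMap_br_mul_comm (G : Type) [Group G] (m : G) (L : Subgroup G) (x : G) :
    stringQuotMap G m L (br m (m * x)) = stringQuotMap G m L (br m (x * m)) :=
  (RingCon.eq _).2 <| (TwoSidedIdeal.rel_iff _ _ _).2 <|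
    TwoSidedIdeal.subset_span (Or.inr ⟨x, rfl⟩)

theorem commute_stringQuotMap_br_one (G : Type) [Group G] (m : G) (L : Subgroup G)
    (q : StringQuot G m L) : Commute (stringQuotMap G m L (br m 1)) q := by
  obtain ⟨z, rfl⟩ := stringQuotMap_surjective G m L q
  induction z using Unitization.ind with
  | inl_add_inr n u =>
    rw [map_add]
    refine Commute.add_right ?_ ?_
    · have h : (Unitization.inl n : Unitization ℤ (Rm G m)) = (n : Unitization ℤ (Rm G m)) :=
        map_intCast (Unitization.inlRingHom ℤ (Rm G m)) n
      rw [h, map_intCast]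
      exact Int.commute_cast _ n
    · induction u using Rm.induction with
      | h_zero => simp
      | h_el x =>
        change stringQuotMap G m L (br m 1) * stringQuotMap G m L (br m x) =
          stringQuotMap G m L (br m x) * stringQuotMap G m L (br m 1)
        rw [← map_mul, ← map_mul, br_mul_br, br_mul_br, map_add, map_add]
        simp only [one_mul, mul_one]
        rw [stringQuotMap_br_mul_comm]
      | h_add a b ha hb =>
        rw [Unitization.inr_add, map_add]
        exact ha.add_right hb
      | h_zsmul n a ha =>
        rw [Unitization.inr_smul, map_zsmul]
        exact Commute.smul_right ha n

/-- The element `𝔢 - 1` is a unit of `R_m(1)`, with inverse `𝔪̄ - 1`. -/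
def meridianUnit {G : Type} [Group G] (m : G) : (Unitization ℤ (Rm G m))ˣ where
  val := br m 1 - 1
  inv := br m m⁻¹ - 1
  val_inv := by
    simp only [mul_sub, sub_mul, br_mul_br, mul_one, one_mul, mul_inv_cancel]
    abel
  inv_val := by
    simp only [mul_sub, sub_mul, br_mul_br, mul_one, one_mul, inv_mul_cancel]
    abel

/-- There is a ring homomorphism `φ : ℤ[μ^{±1}] → Q` with `φ(μ) = π(𝔢 - 1)` and
`φ(μ⁻¹) = π(𝔪̄ - 1)`, whose image lies in the center of `Q`; in particular `Q` is an
algebra over the group ring of an infinite cyclic group. -/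
theorem exists_central_laurent_hom (G : Type) [Group G] (m : G) (L : Subgroup G) :
    ∃ φ : LaurentPolynomial ℤ →+* StringQuot G m L,
      φ (LaurentPolynomial.T 1) = stringQuotMap G m L (br m 1 - 1) ∧
      φ (LaurentPolynomial.T (-1)) = stringQuotMap G m L (br m m⁻¹ - 1) ∧
      ∀ (p : LaurentPolynomial ℤ) (q : StringQuot G m L), Commute (φ p) q := by
  exact exists_laurentPolynomial_hom_commute
    (Units.map (stringQuotMap G m L : _ →* StringQuot G m L) (meridianUnit m)) fun q => by
      change Commute (stringQuotMap G m L (br m 1 - 1)) q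
      rw [map_sub, map_one]
      exact (commute_stringQuotMap_br_one G m L q).sub_left (Commute.one_left q)
end
end

section
/- Let G be an infinite cyclic group with generator m (and identity 1). Then the ring homomorphism from the Laurent polynomial ring ℤ[μ^{±1}] to the unitization R_m(1) determined by μ ↦ 𝔢 − 1 and μ⁻¹ ↦ 𝔪̄ − 1 is a ring isomorphism. -/
noncomputable section

namespace Rm

variable {G : Type} [Group G] {m : G}

/-- Multiplication by the twisting element, as a non-unital algebra homomorphism
`R_m → ℤ[G]`. -/
def mulTw (G : Type) [Group G] (m : G) : Rm G m →ₙₐ[ℤ] MonoidAlgebra ℤ G where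
  toFun u := u.val * tw G m
  map_smul' n u := by simp [mul_assoc]
  map_zero' := by simp
  map_add' u v := by simp [add_mul]
  map_mul' u v := by simp [mul_assoc]

/-- The algebra homomorphism `R_m(1) → ℤ[G]`, `(a, u) ↦ a + u · ([1] + [m])`. -/
def toGroupRing (G : Type) [Group G] (m : G) :
    Unitization ℤ (Rm G m) →ₐ[ℤ] MonoidAlgebra ℤ G :=
  Unitization.lift (mulTw G m)

theorem toGroupRing_apply (x : Unitization ℤ (Rm G m)) :
    toGroupRing G m x = algebraMap ℤ _ x.fst + x.snd.val * tw G m := rfl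

theorem toGroupRing_br (x : G) :
    toGroupRing G m (br m x) = MonoidAlgebra.single x 1 + MonoidAlgebra.single (x * m) 1 := by
  simp [toGroupRing_apply, br, el, tw, mul_add, MonoidAlgebra.single_mul_single]

theorem toGroupRing_br_one_sub_one :
    toGroupRing G m (br m 1 - 1) = MonoidAlgebra.single m 1 := by
  simp [toGroupRing_br, MonoidAlgebra.one_def]

theorem toGroupRing_br_inv_sub_one :
    toGroupRing G m (br m m⁻¹ - 1) = MonoidAlgebra.single m⁻¹ 1 := by
  simp [toGroupRing_br, MonoidAlgebra.one_def]

end Rm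

theorem bijective_zpowersHom {G : Type*} [Group G] {m : G}
    (hgen : ∀ g : G, ∃ k : ℤ, g = m ^ k) (hinf : ∀ k : ℤ, m ^ k = 1 → k = 0) :
    Function.Bijective (zpowersHom G m) := by
  refine ⟨(injective_iff_map_eq_one _).2 fun k hk => ?_, fun g => ?_⟩
  · exact hinf k.toAdd (by simpa [zpowersHom_apply] using hk)
  · obtain ⟨k, rfl⟩ := hgen g
    exact ⟨.ofAdd k, by simp [zpowersHom_apply]⟩

namespace LaurentPolynomial

/-- A ring homomorphism to `ℤ[T;T⁻¹]` whose range contains `T` and `T⁻¹` is surjective. -/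
theorem surjective_of_T_mem_range {S : Type*} [Ring S] (F : S →+* ℤ[T;T⁻¹])
    (h₁ : T 1 ∈ F.range) (h₂ : T (-1) ∈ F.range) : Function.Surjective F := by
  intro p
  change p ∈ F.range
  have hC (a : ℤ) : C a ∈ F.range := ⟨a, by simp⟩
  induction p using LaurentPolynomial.induction_on with
  | h_C a => exact hC a
  | h_add hp hq => exact add_mem hp hq
  | h_C_mul_T n a h => rw [T_add, ← mul_assoc]; exact mul_mem h h₁
  | h_C_mul_T_Z n a h => rw [T_sub, ← mul_assoc]; exact mul_mem h h₂

/-- Evaluation at `T = -1` shows that a multiple of `1 + T` is constant only if it vanishes. -/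
theorem eq_zero_of_C_add_mul_one_add_T_eq_zero {a : ℤ} {q : ℤ[T;T⁻¹]}
    (h : C a + q * (1 + T 1) = 0) : a = 0 ∧ q = 0 := by
  have ha : a = 0 := by
    simpa using congrArg (eval₂ (RingHom.id ℤ) (-1 : ℤˣ)) h
  have hT : (1 + T 1 : ℤ[T;T⁻¹]) ≠ 0 := by
    intro h0
    simpa using congrArg (eval₂ (RingHom.id ℤ) (1 : ℤˣ)) h0
  subst ha
  exact ⟨rfl, by simpa [hT] using h⟩

end LaurentPolynomial

/-- If `G` is an infinite cyclic group with generator `m`, then the ring homomorphism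
`ℤ[μ^{±1}] → R_m(1)` determined by `μ ↦ 𝔢 - 1`, `μ⁻¹ ↦ 𝔪̄ - 1` is a ring isomorphism. -/
theorem laurent_equiv_unitization_of_infinite_cyclic (G : Type) [Group G] (m : G)
    (hgen : ∀ g : G, ∃ k : ℤ, g = m ^ k) (hinf : ∀ k : ℤ, m ^ k = 1 → k = 0) :
    ∃ f : LaurentPolynomial ℤ ≃+* Unitization ℤ (Rm G m),
      f (LaurentPolynomial.T 1) = br m 1 - 1 ∧
      f (LaurentPolynomial.T (-1)) = br m m⁻¹ - 1 := by
  let e : LaurentPolynomial ℤ ≃+* MonoidAlgebra ℤ G :=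
    (AddMonoidAlgebra.toMultiplicative ℤ ℤ).trans
      (MonoidAlgebra.mapDomainRingEquiv ℤ
        (MulEquiv.ofBijective (zpowersHom G m) (bijective_zpowersHom hgen hinf)))
  have he (n : ℤ) : e (LaurentPolynomial.T n) = MonoidAlgebra.single (m ^ n) 1 := by
    simp [e, LaurentPolynomial.T, zpowersHom_apply, -LaurentPolynomial.single_eq_C_mul_T]
  let F : Unitization ℤ (Rm G m) →+* LaurentPolynomial ℤ :=
    (e.symm : MonoidAlgebra ℤ G →+* LaurentPolynomial ℤ).comp (Rm.toGroupRing G m)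
  have hF₁ : F (br m 1 - 1) = LaurentPolynomial.T 1 := by
    change e.symm (Rm.toGroupRing G m _) = _
    rw [Rm.toGroupRing_br_one_sub_one, RingEquiv.symm_apply_eq, he, zpow_one]
  have hF₂ : F (br m m⁻¹ - 1) = LaurentPolynomial.T (-1) := by
    change e.symm (Rm.toGroupRing G m _) = _
    rw [Rm.toGroupRing_br_inv_sub_one, RingEquiv.symm_apply_eq, he, zpow_neg_one]
  have htw : e.symm (Rm.tw G m) = 1 + LaurentPolynomial.T 1 := by
    rw [RingEquiv.symm_apply_eq, map_add, map_one, he, zpow_one, Rm.tw, MonoidAlgebra.one_def]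
  have hF (x : Unitization ℤ (Rm G m)) :
      F x = LaurentPolynomial.C x.fst + e.symm x.snd.val * (1 + LaurentPolynomial.T 1) := by
    change e.symm (Rm.toGroupRing G m x) = _
    rw [Rm.toGroupRing_apply, map_add, map_mul, htw]
    simp
  have hinj : Function.Injective F := by
    refine (injective_iff_map_eq_zero F).2 fun x hx => ?_
    rw [hF] at hx
    obtain ⟨h₁, h₂⟩ := LaurentPolynomial.eq_zero_of_C_add_mul_one_add_T_eq_zero hx
    exact Unitization.ext h₁ (Rm.val_injective (by simpa using h₂))
  have hsurj : Function.Surjective F :=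
    LaurentPolynomial.surjective_of_T_mem_range F ⟨_, hF₁⟩ ⟨_, hF₂⟩
  refine ⟨(RingEquiv.ofBijective F ⟨hinj, hsurj⟩).symm, ?_, ?_⟩
  · rw [RingEquiv.symm_apply_eq]; exact hF₁.symm
  · rw [RingEquiv.symm_apply_eq]; exact hF₂.symm
end
end

section
/- Let G be a group with identity element 1 and let m ∈ G. For every integer k ≥ 0, in the unitization R_m(1) one has (𝔢 − 1)^k = (−1)^k·1 + Σ_{i=1}^{k} (−1)^{k−i} [m^{i−1}]. -/
noncomputable section

/-- In `R_m(1)` left multiplication by `𝔢 - 1` acts on basis elements as left translation by `m`. -/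
theorem br_one_sub_one_mul_br {G : Type} [Group G] (m x : G) :
    (br m 1 - 1) * br m x = br m (m * x) := by
  have h : br m 1 * br m x = br m x + br m (m * x) := by
    simp only [br, ← Unitization.inr_mul, ← Unitization.inr_add]
    congr 1
    apply Rm.val_injective
    simp [el, Rm.tw, mul_add, add_mul, MonoidAlgebra.single_mul_single]
  rw [sub_mul, one_mul, h, add_sub_cancel_left]

/-- For every `k ≥ 0`, in `R_m(1)` one has
`(𝔢 - 1)^k = (-1)^k · 1 + ∑_{i=1}^{k} (-1)^{k-i} [m^{i-1}]`. -/
theorem e_sub_one_pow (G : Type) [Group G] (m : G) (k : ℕ) :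
    (br m 1 - 1) ^ k =
      (-1 : Unitization ℤ (Rm G m)) ^ k * 1 +
        ∑ i ∈ Finset.Icc 1 k, (-1 : Unitization ℤ (Rm G m)) ^ (k - i) * br m (m ^ (i - 1)) := by
  have reindex (n : ℕ) :
      ∑ i ∈ Finset.Icc 1 n, (-1 : Unitization ℤ (Rm G m)) ^ (n - i) * br m (m ^ (i - 1)) =
        ∑ i ∈ Finset.range n, (-1) ^ (n - (i + 1)) * br m (m ^ i) := by
    rw [Finset.range_eq_Ico, ← Finset.Ico_add_one_right_eq_Icc, Finset.sum_Ico_eq_sum_range,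
      Finset.range_eq_Ico]
    simp [add_comm]
  rw [reindex]
  induction k with
  | zero => simp
  | succ k ih =>
    have shift : (br m 1 - 1) *
        ∑ i ∈ Finset.range k, (-1) ^ (k - (i + 1)) * br m (m ^ i) =
        ∑ i ∈ Finset.range k, (-1) ^ (k - (i + 1)) * br m (m ^ (i + 1)) := by
      rw [Finset.mul_sum]
      refine Finset.sum_congr rfl fun i _ => ?_
      rw [← mul_assoc, ((Commute.neg_one_right (br m 1 - 1)).pow_right _).eq, mul_assoc,
        br_one_sub_one_mul_br, ← pow_succ']
    rw [pow_succ', ih, mul_add, shift, Finset.sum_range_succ', mul_one, mul_one,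
      ((Commute.neg_one_right (br m 1 - 1)).pow_right _).eq, mul_sub, mul_one, pow_succ]
    simp only [Nat.add_sub_add_right, pow_zero, zero_add, Nat.add_sub_cancel, mul_neg,
      mul_one]
    abel
end
end

section
/- Let G be a group with identity element 1 and let m ∈ G. For every integer k ≥ 0, in the unitization R_m(1) one has (𝔪̄ − 1)^k = (−1)^k·1 + Σ_{i=1}^{k} (−1)^{k−i} [m^{−i}]. -/
noncomputable section

/-- Right multiplication by `𝔪̄ - 1` sends `[x]` to `[x m⁻¹]`. -/
theorem br_mul_mbar_sub_one {G : Type} [Group G] (m x : G) :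
    br m x * (br m m⁻¹ - 1) = br m (x * m⁻¹) := by
  rw [mul_sub, br_mul_br, mul_one, mul_inv_cancel_right, add_sub_cancel_right]

theorem mbar_mul_mbar_sub_one_pow {G : Type} [Group G] (m : G) (k : ℕ) :
    br m m⁻¹ * (br m m⁻¹ - 1) ^ k = br m (m ^ (-((k + 1 : ℕ) : ℤ))) := by
  induction k with
  | zero => simp
  | succ k ih =>
    rw [pow_succ, ← mul_assoc, ih, br_mul_mbar_sub_one, ← zpow_sub_one]
    rfl

/-- For every `k ≥ 0`, in `R_m(1)` one has
`(𝔪̄ - 1)^k = (-1)^k · 1 + ∑_{i=1}^{k} (-1)^{k-i} [m^{-i}]`. -/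
theorem mbar_sub_one_pow (G : Type) [Group G] (m : G) (k : ℕ) :
    (br m m⁻¹ - 1) ^ k =
      (-1 : Unitization ℤ (Rm G m)) ^ k * 1 +
        ∑ i ∈ Finset.Icc 1 k,
          (-1 : Unitization ℤ (Rm G m)) ^ (k - i) * br m (m ^ (-(i : ℤ))) := by
  induction k with
  | zero => simp
  | succ k ih =>
    have step : (br m m⁻¹ - 1) ^ (k + 1) =
        br m (m ^ (-((k + 1 : ℕ) : ℤ))) - (br m m⁻¹ - 1) ^ k := by
      rw [pow_succ', sub_mul, one_mul, mbar_mul_mbar_sub_one_pow]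
    have hsum : ∑ i ∈ Finset.Icc 1 k,
          (-1 : Unitization ℤ (Rm G m)) ^ (k + 1 - i) * br m (m ^ (-(i : ℤ))) =
        -∑ i ∈ Finset.Icc 1 k,
          (-1 : Unitization ℤ (Rm G m)) ^ (k - i) * br m (m ^ (-(i : ℤ))) := by
      rw [← Finset.sum_neg_distrib]
      refine Finset.sum_congr rfl fun i hi => ?_
      rw [Nat.sub_add_comm (Finset.mem_Icc.mp hi).2, pow_succ', neg_one_mul, neg_mul]
    rw [step, ih, Finset.sum_Icc_succ_top (by omega), hsum, Nat.sub_self, pow_zero, one_mul,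
      pow_succ', neg_one_mul, neg_mul]
    abel
end
end

section
/- Let G be a group with identity element 1 and let m ∈ G. For every integer k ≥ 1, in the unitization R_m(1) one has (𝔢 − 1)^k + (𝔢 − 1)^{k−1} = [m^{k−1}] and (𝔪̄ − 1)^k + (𝔪̄ − 1)^{k−1} = [m^{−k}]. -/
noncomputable section

theorem br_inv_sub_one_mul_br {G : Type} [Group G] (m x : G) :
    (br m m⁻¹ - 1) * br m x = br m (m⁻¹ * x) := by
  rw [sub_mul, br_mul_br, inv_mul_cancel, one_mul, one_mul, add_sub_cancel_right]

/-- If left multiplication by `br m a - 1` acts on basis elements as left translation by `g`,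
then consecutive powers of `br m a - 1` sum to a basis element. -/
theorem pow_succ_add_pow_of_mul_br {G : Type} [Group G] {m a g : G}
    (h : ∀ x, (br m a - 1) * br m x = br m (g * x)) (n : ℕ) :
    (br m a - 1) ^ (n + 1) + (br m a - 1) ^ n = br m (g ^ n * a) := by
  induction n with
  | zero => simp
  | succ n ih =>
    calc (br m a - 1) ^ (n + 1 + 1) + (br m a - 1) ^ (n + 1)
        = (br m a - 1) * ((br m a - 1) ^ (n + 1) + (br m a - 1) ^ n) := by
          rw [mul_add, ← pow_succ', ← pow_succ']
      _ = br m (g ^ (n + 1) * a) := by rw [ih, h, pow_succ', mul_assoc]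

/-- For every `k ≥ 1`, in `R_m(1)` one has `(𝔢 - 1)^k + (𝔢 - 1)^{k-1} = [m^{k-1}]` and
`(𝔪̄ - 1)^k + (𝔪̄ - 1)^{k-1} = [m^{-k}]`. -/
theorem pow_add_pow_pred (G : Type) [Group G] (m : G) (k : ℕ) (hk : 1 ≤ k) :
    (br m 1 - 1) ^ k + (br m 1 - 1) ^ (k - 1) = br m (m ^ (k - 1)) ∧
      (br m m⁻¹ - 1) ^ k + (br m m⁻¹ - 1) ^ (k - 1) = br m (m ^ (-(k : ℤ))) := by
  obtain ⟨n, rfl⟩ := Nat.exists_eq_add_of_le' hk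
  rw [Nat.add_sub_cancel, pow_succ_add_pow_of_mul_br (br_one_sub_one_mul_br m),
    pow_succ_add_pow_of_mul_br (br_inv_sub_one_mul_br m), mul_one, ← pow_succ, inv_pow,
    zpow_neg, zpow_natCast]
  exact ⟨rfl, rfl⟩
end
end

section
/- Let G be a group with identity element 1 and let m ∈ G. There is a ring isomorphism Φ from the unitization R_m(1) to the quotient of T(V) by the two-sided ideal generated by relation (4) alone, such that Φ(1) = 1 and Φ carries the element [x] of the ℤ[G]-summand of R_m(1) to the class of the generator [x], for every x ∈ G. -/
noncomputable section

/-- The generators of the ideal of relation (4): `[xy] + [xmy] - [x]·[y]`, in the tensor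
algebra `T(V)` (the free unital associative `ℤ`-algebra on the set `G`). -/
def rel4Set (G : Type) [Group G] (m : G) : Set (FreeAlgebra ℤ G) :=
  {z | ∃ x y : G, z = FreeAlgebra.ι ℤ (x * y) + FreeAlgebra.ι ℤ (x * m * y)
      - FreeAlgebra.ι ℤ x * FreeAlgebra.ι ℤ y}

/-- The quotient of `T(V)` by the two-sided ideal generated by relation (4) alone. -/
abbrev Rel4Quot (G : Type) [Group G] (m : G) :=
  (TwoSidedIdeal.span (rel4Set G m)).ringCon.Quotient

/-- The quotient map `T(V) → T(V)/(4)`. -/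
def rel4QuotMap (G : Type) [Group G] (m : G) : FreeAlgebra ℤ G →+* Rel4Quot G m :=
  RingCon.mk' _

open FreeAlgebra in
theorem rel4QuotMap_mul_basis {G : Type} [Group G] (m x y : G) :
    rel4QuotMap G m (ι ℤ x) * rel4QuotMap G m (ι ℤ y)
      = rel4QuotMap G m (ι ℤ (x * y)) + rel4QuotMap G m (ι ℤ (x * m * y)) := by
  rw [← map_mul, ← map_add]
  refine ((RingCon.eq _).2 ?_).symm
  rw [TwoSidedIdeal.rel_iff]
  exact TwoSidedIdeal.subset_span ⟨x, y, rfl⟩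

namespace Rm

variable {G : Type} [Group G] {m : G}

@[elab_as_elim]
theorem induction_basis {p : Rm G m → Prop} (u : Rm G m) (zero : p 0)
    (add : ∀ u v, p u → p v → p (u + v)) (zsmul_el : ∀ (n : ℤ) x, p (n • el m x)) : p u := by
  obtain ⟨u⟩ := u
  induction u using MonoidAlgebra.induction_linear with
  | zero => exact zero
  | add f g hf hg => exact add _ _ hf hg
  | single x n =>
    have h : (⟨MonoidAlgebra.single x n⟩ : Rm G m) = n • el m x := val_injective (by simp [el])
    exact h ▸ zsmul_el n x

theorem el_mul_el (x y : G) : el m x * el m y = el m (x * y) + el m (x * m * y) := by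
  apply val_injective
  simp [el, tw, mul_add, add_mul, MonoidAlgebra.single_mul_single]

/-- The additive map `R_m → T(V)/(4)` sending `[x]` to the class of the generator `[x]`. -/
def toRel4QuotAdd (G : Type) [Group G] (m : G) : Rm G m →+ Rel4Quot G m where
  toFun u := u.val.coeff.sum fun x n => n • rel4QuotMap G m (FreeAlgebra.ι ℤ x)
  map_zero' := by simp
  map_add' u v := by
    simp only [add_val, MonoidAlgebra.coeff_add]
    exact Finsupp.sum_add_index' (by simp) (by simp [add_smul])

@[simp] theorem toRel4QuotAdd_el (x : G) :
    toRel4QuotAdd G m (el m x) = rel4QuotMap G m (FreeAlgebra.ι ℤ x) := by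
  simp [toRel4QuotAdd, el]

theorem toRel4QuotAdd_mul (u v : Rm G m) :
    toRel4QuotAdd G m (u * v) = toRel4QuotAdd G m u * toRel4QuotAdd G m v := by
  induction u using induction_basis with
  | zero => simp
  | add u u' hu hu' => simp only [add_mul, map_add, hu, hu']
  | zsmul_el k x =>
    induction v using induction_basis with
    | zero => simp
    | add v v' hv hv' => simp only [mul_add, map_add, hv, hv']
    | zsmul_el l y =>
      simp only [smul_mul_assoc, mul_smul_comm, map_zsmul, el_mul_el, map_add, toRel4QuotAdd_el,
        rel4QuotMap_mul_basis]

/-- `toRel4QuotAdd` as a homomorphism of non-unital `ℤ`-algebras. -/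
def toRel4Quot (G : Type) [Group G] (m : G) : Rm G m →ₙₐ[ℤ] Rel4Quot G m where
  toFun := toRel4QuotAdd G m
  map_smul' n u := map_zsmul (toRel4QuotAdd G m) n u
  map_zero' := map_zero _
  map_add' := map_add _
  map_mul' := toRel4QuotAdd_mul

end Rm

/-- The homomorphism `R_m(1) → T(V)/(4)` extending `Rm.toRel4Quot`. -/
def unitizationToRel4Quot (G : Type) [Group G] (m : G) :
    Unitization ℤ (Rm G m) →+* Rel4Quot G m :=
  (Unitization.lift (Rm.toRel4Quot G m)).toRingHom

theorem unitizationToRel4Quot_br {G : Type} [Group G] (m x : G) :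
    unitizationToRel4Quot G m (br m x) = rel4QuotMap G m (FreeAlgebra.ι ℤ x) := by
  exact (Unitization.lift_symm_apply_apply (Unitization.lift (Rm.toRel4Quot G m)) (el m x)).symm.trans
    ((DFunLike.congr_fun (Unitization.lift.symm_apply_apply _) _).trans (Rm.toRel4QuotAdd_el x))

/-- The homomorphism `T(V)/(4) → R_m(1)` sending the class of the generator `[x]` to `[x]`. -/
def rel4QuotToUnitization (G : Type) [Group G] (m : G) :
    Rel4Quot G m →+* Unitization ℤ (Rm G m) :=
  RingCon.lift _ (FreeAlgebra.lift ℤ (br m)).toRingHom <| by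
    have h : TwoSidedIdeal.span (rel4Set G m) ≤
        TwoSidedIdeal.ker (FreeAlgebra.lift ℤ (br m)).toRingHom := by
      rw [TwoSidedIdeal.span_le]
      rintro _ ⟨x, y, rfl⟩
      simp [TwoSidedIdeal.mem_ker, br_mul_br]
    intro a b hab
    rw [TwoSidedIdeal.rel_iff] at hab
    simpa [TwoSidedIdeal.mem_ker, sub_eq_zero] using h hab

theorem rel4QuotToUnitization_ι {G : Type} [Group G] (m x : G) :
    rel4QuotToUnitization G m (rel4QuotMap G m (FreeAlgebra.ι ℤ x)) = br m x :=
  FreeAlgebra.lift_ι_apply (R := ℤ) (br m) x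

theorem Rel4Quot.ringHom_ext {G : Type} [Group G] {m : G} {S : Type*} [Ring S]
    {f g : Rel4Quot G m →+* S}
    (h : ∀ x, f (rel4QuotMap G m (FreeAlgebra.ι ℤ x)) = g (rel4QuotMap G m (FreeAlgebra.ι ℤ x))) :
    f = g := by
  have hfg : (f.comp (rel4QuotMap G m)).toIntAlgHom = (g.comp (rel4QuotMap G m)).toIntAlgHom :=
    FreeAlgebra.hom_ext (funext h)
  refine RingHom.ext fun q => ?_
  obtain ⟨a, rfl⟩ := RingCon.mk'_surjective _ q
  exact DFunLike.congr_fun hfg a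

theorem Rm.unitization_ringHom_ext {G : Type} [Group G] {m : G} {S : Type*} [Ring S]
    {f g : Unitization ℤ (Rm G m) →+* S} (h : ∀ x, f (br m x) = g (br m x)) : f = g := by
  ext u
  induction u using Unitization.ind with
  | inl_add_inr n u =>
    have hn : (Unitization.inl n : Unitization ℤ (Rm G m)) = n :=
      map_intCast (Unitization.inlRingHom ℤ (Rm G m)) n
    rw [map_add, map_add, hn, map_intCast, map_intCast]
    congr 1
    induction u using Rm.induction_basis with
    | zero => simp
    | add u v hu hv => simp only [Unitization.inr_add, map_add, hu, hv]
    | zsmul_el k x =>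
      have := h x
      simp only [br] at this
      simp only [Unitization.inr_smul, map_zsmul, this]

/-- There is a ring isomorphism `Φ : R_m(1) ≃ T(V)/(4)` with `Φ(1) = 1` (automatic) carrying
`[x]` in the `ℤ[G]`-summand to the class of the generator `[x]`. -/
theorem unitization_equiv_rel4_quot (G : Type) [Group G] (m : G) :
    ∃ Φ : Unitization ℤ (Rm G m) ≃+* Rel4Quot G m,
      ∀ x : G, Φ (br m x) = rel4QuotMap G m (FreeAlgebra.ι ℤ x) := by
  refine ⟨RingEquiv.ofRingHom (unitizationToRel4Quot G m) (rel4QuotToUnitization G m)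
    (Rel4Quot.ringHom_ext fun x => ?_) (Rm.unitization_ringHom_ext fun x => ?_),
    unitizationToRel4Quot_br m⟩
  · simp [rel4QuotToUnitization_ι, unitizationToRel4Quot_br]
  · simp [rel4QuotToUnitization_ι, unitizationToRel4Quot_br]
end
end

section
/- Let G be a group with identity element 1 and m ∈ G, and let ℤ[μ^{±1}] denote the Laurent polynomial ring over ℤ. In the quotient of the free unital associative ℤ[μ^{±1}]-algebra T(V_μ) on G by the two-sided ideal generated by relations (4) and (7) alone, the relations [mx] = μ[x] and [m⁻¹x] = μ⁻¹[x] hold for every x ∈ G; that is, relation (8) follows from relations (4) and (7). -/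
noncomputable section

open LaurentPolynomial

/-- The generators of the ideal of relation (4): `[xy] + [xmy] - [x]·[y]`, in the free
unital associative `ℤ[μ^{±1}]`-algebra `T(V_μ)` on the set `G`. -/
def rel4SetMu (G : Type) [Group G] (m : G) : Set (FreeAlgebra (LaurentPolynomial ℤ) G) :=
  {z | ∃ x y : G, z = FreeAlgebra.ι _ (x * y) + FreeAlgebra.ι _ (x * m * y)
      - FreeAlgebra.ι _ x * FreeAlgebra.ι _ y}

/-- The generator of the ideal of relation (7): `[1] - (1 + μ)`, in `T(V_μ)`. -/
def rel7SetMu (G : Type) [Group G] : Set (FreeAlgebra (LaurentPolynomial ℤ) G) :=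
  {z | z = FreeAlgebra.ι _ (1 : G)
      - (1 + algebraMap (LaurentPolynomial ℤ) (FreeAlgebra (LaurentPolynomial ℤ) G) (T 1))}

/-- The quotient of `T(V_μ)` by the two-sided ideal generated by relations (4) and (7). -/
abbrev Rel47Quot (G : Type) [Group G] (m : G) :=
  (TwoSidedIdeal.span (rel4SetMu G m ∪ rel7SetMu G)).ringCon.Quotient

/-- The quotient map `T(V_μ) → T(V_μ)/((4),(7))`. -/
def rel47QuotMap (G : Type) [Group G] (m : G) :
    FreeAlgebra (LaurentPolynomial ℤ) G →+* Rel47Quot G m :=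
  RingCon.mk' _

theorem rel47QuotMap_ι_add (G : Type) [Group G] (m x y : G) :
    rel47QuotMap G m (FreeAlgebra.ι _ (x * y)) + rel47QuotMap G m (FreeAlgebra.ι _ (x * m * y)) =
      rel47QuotMap G m (FreeAlgebra.ι _ x) * rel47QuotMap G m (FreeAlgebra.ι _ y) := by
  rw [← map_add, ← map_mul]
  refine (RingCon.eq _).2 ((TwoSidedIdeal.rel_iff _ _ _).2 ?_)
  exact TwoSidedIdeal.subset_span (Or.inl ⟨x, y, rfl⟩)

theorem rel47QuotMap_ι_one (G : Type) [Group G] (m : G) :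
    rel47QuotMap G m (FreeAlgebra.ι _ 1) =
      1 + rel47QuotMap G m (algebraMap (LaurentPolynomial ℤ) _ (T 1)) := by
  rw [← map_one (rel47QuotMap G m), ← map_add]
  refine (RingCon.eq _).2 ((TwoSidedIdeal.rel_iff _ _ _).2 ?_)
  exact TwoSidedIdeal.subset_span (Or.inr rfl)

theorem rel47QuotMap_ι_mul (G : Type) [Group G] (m x : G) :
    rel47QuotMap G m (FreeAlgebra.ι _ (m * x)) =
      rel47QuotMap G m (algebraMap (LaurentPolynomial ℤ) _ (T 1) * FreeAlgebra.ι _ x) := by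
  have h := rel47QuotMap_ι_add G m 1 x
  rw [rel47QuotMap_ι_one, one_mul, one_mul, add_mul, one_mul, ← map_mul] at h
  exact add_left_cancel h

/-- In the quotient of `T(V_μ)` by relations (4) and (7) alone, the relations
`[mx] = μ[x]` and `[m⁻¹x] = μ⁻¹[x]` hold for every `x ∈ G`; i.e. relation (8) follows
from relations (4) and (7). -/
theorem rel8_of_rel4_rel7 (G : Type) [Group G] (m : G) (x : G) :
    rel47QuotMap G m (FreeAlgebra.ι _ (m * x)) =
        rel47QuotMap G m
          (algebraMap (LaurentPolynomial ℤ) (FreeAlgebra (LaurentPolynomial ℤ) G) (T 1)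
            * FreeAlgebra.ι _ x) ∧
      rel47QuotMap G m (FreeAlgebra.ι _ (m⁻¹ * x)) =
        rel47QuotMap G m
          (algebraMap (LaurentPolynomial ℤ) (FreeAlgebra (LaurentPolynomial ℤ) G) (T (-1))
            * FreeAlgebra.ι _ x) := by
  refine ⟨rel47QuotMap_ι_mul G m x, ?_⟩
  have h := rel47QuotMap_ι_mul G m (m⁻¹ * x)
  rw [mul_inv_cancel_left] at h
  rw [map_mul, h, ← map_mul, ← mul_assoc, ← map_mul, ← T_add]
  simp
end
end

section
/- Let G be a group with identity element 1, m ∈ G, and L a subgroup of G, and let A = A(G,m,L). Then ([1] − 1)·([m⁻¹] − 1) = 1 and ([m⁻¹] − 1)·([1] − 1) = 1 in A; in particular [1] − 1 is a unit of A with inverse [m⁻¹] − 1. -/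
noncomputable section

/-- The generators of the two-sided ideal of relations (4), (5), (6) in the tensor algebra
`T(V)`, the free unital associative `ℤ`-algebra on the set `G`:
(4) `[xy] + [xmy] - [x]·[y]`; (5) `[lx] - [x]`, `[xl] - [x]` for `l ∈ L`;
(6) `[mx] - [xm]`, `[m⁻¹x] - [xm⁻¹]`. -/
def relASet (G : Type) [Group G] (m : G) (L : Subgroup G) : Set (FreeAlgebra ℤ G) :=
  {z | ∃ x y : G, z = FreeAlgebra.ι ℤ (x * y) + FreeAlgebra.ι ℤ (x * m * y)
      - FreeAlgebra.ι ℤ x * FreeAlgebra.ι ℤ y} ∪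
    {z | ∃ x : G, ∃ l ∈ L, z = FreeAlgebra.ι ℤ (l * x) - FreeAlgebra.ι ℤ x} ∪
    {z | ∃ x : G, ∃ l ∈ L, z = FreeAlgebra.ι ℤ (x * l) - FreeAlgebra.ι ℤ x} ∪
    {z | ∃ x : G, z = FreeAlgebra.ι ℤ (m * x) - FreeAlgebra.ι ℤ (x * m)} ∪
    {z | ∃ x : G, z = FreeAlgebra.ι ℤ (m⁻¹ * x) - FreeAlgebra.ι ℤ (x * m⁻¹)}

/-- The algebra `A = A(G,m,L)`: the quotient of `T(V)` by the two-sided ideal generated by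
relations (4), (5), (6). -/
abbrev AlgA (G : Type) [Group G] (m : G) (L : Subgroup G) :=
  (TwoSidedIdeal.span (relASet G m L)).ringCon.Quotient

/-- The quotient map `T(V) → A(G,m,L)`. -/
def algAMap (G : Type) [Group G] (m : G) (L : Subgroup G) : FreeAlgebra ℤ G →+* AlgA G m L :=
  RingCon.mk' _

/-- The multiplication rule for generators of `A(G,m,L)`: `[x]·[y] = [xy] + [xmy]`. -/
theorem algAMap_ι_mul_ι {G : Type} [Group G] (m : G) (L : Subgroup G) (x y : G) :
    algAMap G m L (FreeAlgebra.ι ℤ x) * algAMap G m L (FreeAlgebra.ι ℤ y) =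
      algAMap G m L (FreeAlgebra.ι ℤ (x * y)) + algAMap G m L (FreeAlgebra.ι ℤ (x * m * y)) := by
  rw [← map_mul, ← map_add]
  refine ((RingCon.eq _).2 ((TwoSidedIdeal.rel_iff _ _ _).2 ?_)).symm
  exact TwoSidedIdeal.subset_span (.inl (.inl (.inl (.inl ⟨x, y, rfl⟩))))

/-- In `A = A(G,m,L)` one has `([1] - 1)·([m⁻¹] - 1) = 1` and `([m⁻¹] - 1)·([1] - 1) = 1`;
in particular `[1] - 1` is a unit of `A` with inverse `[m⁻¹] - 1`. -/
theorem one_sub_one_mul_minv_sub_one (G : Type) [Group G] (m : G) (L : Subgroup G) :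
    (algAMap G m L (FreeAlgebra.ι ℤ (1 : G)) - 1) * (algAMap G m L (FreeAlgebra.ι ℤ m⁻¹) - 1)
        = 1 ∧
      (algAMap G m L (FreeAlgebra.ι ℤ m⁻¹) - 1) * (algAMap G m L (FreeAlgebra.ι ℤ (1 : G)) - 1)
        = 1 ∧
      IsUnit (algAMap G m L (FreeAlgebra.ι ℤ (1 : G)) - 1) := by
  have left : (algAMap G m L (FreeAlgebra.ι ℤ (1 : G)) - 1) *
      (algAMap G m L (FreeAlgebra.ι ℤ m⁻¹) - 1) = 1 := by
    rw [sub_mul, mul_sub, algAMap_ι_mul_ι]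
    simp
  have right : (algAMap G m L (FreeAlgebra.ι ℤ m⁻¹) - 1) *
      (algAMap G m L (FreeAlgebra.ι ℤ (1 : G)) - 1) = 1 := by
    rw [sub_mul, mul_sub, algAMap_ι_mul_ι]
    simp
  exact ⟨left, right, ⟨⟨_, _, left, right⟩, rfl⟩⟩
end
end

section
/- Let G be a group with identity element 1, m ∈ G, and L a subgroup of G. Then there is a ring isomorphism f : A_Ng(G,m,L) → A(G,m,L) satisfying f([x]) = [x] for every x ∈ G, f(μ·1) = [1] − 1, and f(μ⁻¹·1) = [m⁻¹] − 1. -/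
noncomputable section

open LaurentPolynomial

/-- The generators of the two-sided ideal of relations (4), (5), (6) in the free unital
associative `ℤ[μ^{±1}]`-algebra `T(V_μ)` on the set `G`. -/
def relASetMu (G : Type) [Group G] (m : G) (L : Subgroup G) :
    Set (FreeAlgebra (LaurentPolynomial ℤ) G) :=
  {z | ∃ x y : G, z = FreeAlgebra.ι _ (x * y) + FreeAlgebra.ι _ (x * m * y)
      - FreeAlgebra.ι _ x * FreeAlgebra.ι _ y} ∪
    {z | ∃ x : G, ∃ l ∈ L, z = FreeAlgebra.ι _ (l * x) - FreeAlgebra.ι _ x} ∪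
    {z | ∃ x : G, ∃ l ∈ L, z = FreeAlgebra.ι _ (x * l) - FreeAlgebra.ι _ x} ∪
    {z | ∃ x : G, z = FreeAlgebra.ι _ (m * x) - FreeAlgebra.ι _ (x * m)} ∪
    {z | ∃ x : G, z = FreeAlgebra.ι _ (m⁻¹ * x) - FreeAlgebra.ι _ (x * m⁻¹)}

/-- The generator of the ideal of relation (7): `[1] - (1 + μ)`, in `T(V_μ)`. -/
def rel7SetMu' (G : Type) [Group G] : Set (FreeAlgebra (LaurentPolynomial ℤ) G) :=
  {z | z = FreeAlgebra.ι _ (1 : G)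
      - (1 + algebraMap (LaurentPolynomial ℤ) (FreeAlgebra (LaurentPolynomial ℤ) G) (T 1))}

/-- The generators of the ideal of relation (8): `[mx] - μ[x]` and `[m⁻¹x] - μ⁻¹[x]`,
in `T(V_μ)`. -/
def rel8SetMu (G : Type) [Group G] (m : G) : Set (FreeAlgebra (LaurentPolynomial ℤ) G) :=
  {z | ∃ x : G, z = FreeAlgebra.ι _ (m * x)
      - algebraMap (LaurentPolynomial ℤ) (FreeAlgebra (LaurentPolynomial ℤ) G) (T 1)
          * FreeAlgebra.ι _ x} ∪
    {z | ∃ x : G, z = FreeAlgebra.ι _ (m⁻¹ * x)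
      - algebraMap (LaurentPolynomial ℤ) (FreeAlgebra (LaurentPolynomial ℤ) G) (T (-1))
          * FreeAlgebra.ι _ x}

/-- Ng's cord algebra `A_Ng(G,m,L)`: the quotient of `T(V_μ)` by the two-sided ideal
generated by relations (4)–(8). -/
abbrev CordAlg (G : Type) [Group G] (m : G) (L : Subgroup G) :=
  (TwoSidedIdeal.span (relASetMu G m L ∪ rel7SetMu' G ∪ rel8SetMu G m)).ringCon.Quotient

/-- The quotient map `T(V_μ) → A_Ng(G,m,L)`. -/
def cordAlgMap (G : Type) [Group G] (m : G) (L : Subgroup G) :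
    FreeAlgebra (LaurentPolynomial ℤ) G →+* CordAlg G m L :=
  RingCon.mk' _

namespace CordAlgebra

section Span

variable {R S : Type*} [Ring R] [Ring S]

/-- The homomorphism on the quotient by the two-sided ideal spanned by `s` induced by a
homomorphism that vanishes on `s`. -/
def liftSpan {s : Set R} (φ : R →+* S) (h : ∀ z ∈ s, φ z = 0) :
    (TwoSidedIdeal.span s).ringCon.Quotient →+* S :=
  RingCon.lift _ φ <| by
    have hle : TwoSidedIdeal.span s ≤ TwoSidedIdeal.ker φ :=
      TwoSidedIdeal.span_le.2 fun z hz ↦ (TwoSidedIdeal.mem_ker φ).2 (h z hz)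
    exact fun x y hxy ↦ TwoSidedIdeal.ringCon_le_iff.1 hle hxy

lemma mk'_eq_zero_of_mem {s : Set R} {z : R} (hz : z ∈ s) :
    (TwoSidedIdeal.span s).ringCon.mk' z = 0 := by
  rw [← TwoSidedIdeal.mem_ker, TwoSidedIdeal.ker_ringCon_mk']
  exact TwoSidedIdeal.subset_span hz

end Span

section Free

variable {X S : Type*} [Ring S]

lemma freeAlgebra_ringHom_ext {R : Type*} [CommSemiring R] {φ ψ : FreeAlgebra R X →+* S}
    (hR : ∀ r, φ (algebraMap R (FreeAlgebra R X) r) = ψ (algebraMap R (FreeAlgebra R X) r))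
    (hι : ∀ x, φ (FreeAlgebra.ι R x) = ψ (FreeAlgebra.ι R x)) : φ = ψ := by
  refine RingHom.ext fun a ↦ ?_
  induction a using FreeAlgebra.induction with
  | grade0 r => exact hR r
  | grade1 x => exact hι x
  | mul a b ha hb => rw [map_mul, map_mul, ha, hb]
  | add a b ha hb => rw [map_add, map_add, ha, hb]

lemma commute_map_freeAlgebra {φ : FreeAlgebra ℤ X →+* S} {u : S}
    (hu : ∀ x, Commute u (φ (FreeAlgebra.ι ℤ x))) (a : FreeAlgebra ℤ X) : Commute u (φ a) := by
  induction a using FreeAlgebra.induction with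
  | grade0 r => simp
  | grade1 x => exact hu x
  | mul a b ha hb => rw [map_mul]; exact ha.mul_right hb
  | add a b ha hb => rw [map_add]; exact ha.add_right hb

lemma laurentPolynomial_ringHom_ext {φ ψ : LaurentPolynomial ℤ →+* S}
    (h : φ (T 1) = ψ (T 1)) (h' : φ (T (-1)) = ψ (T (-1))) : φ = ψ := by
  refine RingHom.ext fun p ↦ ?_
  induction p using LaurentPolynomial.induction_on with
  | h_C a => simp
  | h_add hp hq => rw [map_add, map_add, hp, hq]
  | h_C_mul_T n a ih => rw [T_add, ← mul_assoc, map_mul _ (_ * _), ih, h, ← map_mul]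
  | h_C_mul_T_Z n a ih => rw [T_sub, ← mul_assoc, map_mul _ (_ * _), ih, h', ← map_mul]

end Free

section SkeinRelation

variable {G B : Type*} [Group G] [Ring B] {m : G} (b : G → B)

lemma map_meridian_mul (h : ∀ x y, b (x * y) + b (x * m * y) = b x * b y) (x : G) :
    b (m * x) = (b 1 - 1) * b x := by
  have := h 1 x
  simp only [one_mul] at this
  rw [sub_mul, one_mul, ← this, add_sub_cancel_left]

lemma map_mul_meridian (h : ∀ x y, b (x * y) + b (x * m * y) = b x * b y) (x : G) :
    b (x * m) = b x * (b 1 - 1) := by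
  have := h x 1
  simp only [mul_one] at this
  rw [mul_sub, mul_one, ← this, add_sub_cancel_left]

lemma map_meridian_inv_mul (h : ∀ x y, b (x * y) + b (x * m * y) = b x * b y) (x : G) :
    b (m⁻¹ * x) = (b m⁻¹ - 1) * b x := by
  have := h m⁻¹ x
  simp only [inv_mul_cancel, one_mul] at this
  rw [sub_mul, one_mul, ← this, add_sub_cancel_right]

lemma map_one_sub_one_mul (h : ∀ x y, b (x * y) + b (x * m * y) = b x * b y) :
    (b 1 - 1) * (b m⁻¹ - 1) = 1 := by
  have := map_meridian_mul b h m⁻¹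
  rw [mul_inv_cancel] at this
  rw [mul_sub, ← this, mul_one, sub_sub_cancel]

lemma mul_map_one_sub_one (h : ∀ x y, b (x * y) + b (x * m * y) = b x * b y) :
    (b m⁻¹ - 1) * (b 1 - 1) = 1 := by
  have := map_mul_meridian b h m⁻¹
  rw [inv_mul_cancel] at this
  rw [sub_mul, ← this, one_mul, sub_sub_cancel]

end SkeinRelation

variable (G : Type) [Group G] (m : G) (L : Subgroup G)

section AlgA

lemma algAMap_skein (x y : G) :
    algAMap G m L (FreeAlgebra.ι ℤ (x * y)) + algAMap G m L (FreeAlgebra.ι ℤ (x * m * y)) =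
      algAMap G m L (FreeAlgebra.ι ℤ x) * algAMap G m L (FreeAlgebra.ι ℤ y) := by
  rw [← sub_eq_zero, ← map_add, ← map_mul, ← map_sub]
  exact mk'_eq_zero_of_mem (.inl <| .inl <| .inl <| .inl ⟨x, y, rfl⟩)

lemma algAMap_mul_left {l : G} (hl : l ∈ L) (x : G) :
    algAMap G m L (FreeAlgebra.ι ℤ (l * x)) = algAMap G m L (FreeAlgebra.ι ℤ x) := by
  rw [← sub_eq_zero, ← map_sub]
  exact mk'_eq_zero_of_mem (.inl <| .inl <| .inl <| .inr ⟨x, l, hl, rfl⟩)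

lemma algAMap_mul_right {l : G} (hl : l ∈ L) (x : G) :
    algAMap G m L (FreeAlgebra.ι ℤ (x * l)) = algAMap G m L (FreeAlgebra.ι ℤ x) := by
  rw [← sub_eq_zero, ← map_sub]
  exact mk'_eq_zero_of_mem (.inl <| .inl <| .inr ⟨x, l, hl, rfl⟩)

lemma algAMap_meridian_comm (x : G) :
    algAMap G m L (FreeAlgebra.ι ℤ (m * x)) = algAMap G m L (FreeAlgebra.ι ℤ (x * m)) := by
  rw [← sub_eq_zero, ← map_sub]
  exact mk'_eq_zero_of_mem (.inl <| .inr ⟨x, rfl⟩)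

lemma algAMap_meridian_inv_comm (x : G) :
    algAMap G m L (FreeAlgebra.ι ℤ (m⁻¹ * x)) = algAMap G m L (FreeAlgebra.ι ℤ (x * m⁻¹)) := by
  rw [← sub_eq_zero, ← map_sub]
  exact mk'_eq_zero_of_mem (.inr ⟨x, rfl⟩)

/-- The unit `[1] - 1` of `A`, with inverse `[m⁻¹] - 1`. -/
def meridianUnit : (AlgA G m L)ˣ where
  val := algAMap G m L (FreeAlgebra.ι ℤ 1) - 1
  inv := algAMap G m L (FreeAlgebra.ι ℤ m⁻¹) - 1
  val_inv := map_one_sub_one_mul (algAMap G m L ∘ FreeAlgebra.ι ℤ) (algAMap_skein G m L)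
  inv_val := mul_map_one_sub_one (algAMap G m L ∘ FreeAlgebra.ι ℤ) (algAMap_skein G m L)

lemma commute_meridianUnit (a : AlgA G m L) : Commute (meridianUnit G m L : AlgA G m L) a := by
  obtain ⟨a, rfl⟩ := RingCon.mk'_surjective _ a
  refine commute_map_freeAlgebra (φ := algAMap G m L) (fun x ↦ ?_) a
  let b := algAMap G m L ∘ FreeAlgebra.ι ℤ
  exact (map_meridian_mul b (algAMap_skein G m L) x).symm.trans <|
    (algAMap_meridian_comm G m L x).trans (map_mul_meridian b (algAMap_skein G m L) x)

/-- The unit `[1] - 1`, viewed in the center of `A`. -/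
def centralMeridianUnit : (Subring.center (AlgA G m L))ˣ where
  val := ⟨meridianUnit G m L,
    Subring.mem_center_iff.2 fun a ↦ (commute_meridianUnit G m L a).eq.symm⟩
  inv := ⟨(meridianUnit G m L)⁻¹.val,
    Subring.mem_center_iff.2 fun a ↦ (commute_meridianUnit G m L a).units_inv_left.eq.symm⟩
  val_inv := Subtype.ext (meridianUnit G m L).mul_inv
  inv_val := Subtype.ext (meridianUnit G m L).inv_mul

/-- The map `ℤ[μ^{±1}] → A` sending `μ` to `[1] - 1`. -/
def laurentToAlgA : LaurentPolynomial ℤ →+* AlgA G m L :=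
  (Subring.center (AlgA G m L)).subtype.comp
    (LaurentPolynomial.eval₂ (Int.castRingHom _) (centralMeridianUnit G m L))

lemma laurentToAlgA_T_one :
    laurentToAlgA G m L (T 1) = algAMap G m L (FreeAlgebra.ι ℤ 1) - 1 := by
  simp only [laurentToAlgA, RingHom.comp_apply, LaurentPolynomial.eval₂_T, zpow_one]
  rfl

lemma laurentToAlgA_T_neg_one :
    laurentToAlgA G m L (T (-1)) = algAMap G m L (FreeAlgebra.ι ℤ m⁻¹) - 1 := by
  simp only [laurentToAlgA, RingHom.comp_apply, LaurentPolynomial.eval₂_T, zpow_neg_one]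
  rfl

lemma laurentToAlgA_commutes (p : LaurentPolynomial ℤ) (a : AlgA G m L) :
    laurentToAlgA G m L p * a = a * laurentToAlgA G m L p :=
  (Subring.mem_center_iff.1 (SetLike.coe_mem
    (LaurentPolynomial.eval₂ (Int.castRingHom _) (centralMeridianUnit G m L) p)) a).symm

/-- The map `T(V_μ) → A` sending `[x]` to `[x]` and `μ` to `[1] - 1`. -/
def freeToAlgA : FreeAlgebra (LaurentPolynomial ℤ) G →+* AlgA G m L :=
  letI := (laurentToAlgA G m L).toAlgebra' (laurentToAlgA_commutes G m L)
  (FreeAlgebra.lift (LaurentPolynomial ℤ) fun x ↦ algAMap G m L (FreeAlgebra.ι ℤ x)).toRingHom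

@[simp]
lemma freeToAlgA_ι (x : G) :
    freeToAlgA G m L (FreeAlgebra.ι _ x) = algAMap G m L (FreeAlgebra.ι ℤ x) :=
  letI := (laurentToAlgA G m L).toAlgebra' (laurentToAlgA_commutes G m L)
  FreeAlgebra.lift_ι_apply _ _

@[simp]
lemma freeToAlgA_algebraMap (p : LaurentPolynomial ℤ) :
    freeToAlgA G m L (algebraMap _ _ p) = laurentToAlgA G m L p :=
  letI := (laurentToAlgA G m L).toAlgebra' (laurentToAlgA_commutes G m L)
  AlgHom.commutes _ _

/-- The map `A_Ng → A` sending `[x]` to `[x]` and `μ` to `[1] - 1`. -/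
def cordAlgToAlgA : CordAlg G m L →+* AlgA G m L :=
  liftSpan (freeToAlgA G m L) <| by
    rintro z ((((((⟨x, y, rfl⟩ | ⟨x, l, hl, rfl⟩) | ⟨x, l, hl, rfl⟩) | ⟨x, rfl⟩) | ⟨x, rfl⟩) |
      rfl) | (⟨x, rfl⟩ | ⟨x, rfl⟩)) <;>
    simp only [map_sub, map_add, map_mul, map_one, freeToAlgA_ι, freeToAlgA_algebraMap,
      laurentToAlgA_T_one, laurentToAlgA_T_neg_one, sub_eq_zero]
    · exact algAMap_skein G m L x y
    · exact algAMap_mul_left G m L hl x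
    · exact algAMap_mul_right G m L hl x
    · exact algAMap_meridian_comm G m L x
    · exact algAMap_meridian_inv_comm G m L x
    · abel
    · exact map_meridian_mul (algAMap G m L ∘ FreeAlgebra.ι ℤ) (algAMap_skein G m L) x
    · exact map_meridian_inv_mul (algAMap G m L ∘ FreeAlgebra.ι ℤ) (algAMap_skein G m L) x

lemma cordAlgToAlgA_cordAlgMap (a : FreeAlgebra (LaurentPolynomial ℤ) G) :
    cordAlgToAlgA G m L (cordAlgMap G m L a) = freeToAlgA G m L a :=
  rfl

end AlgA

section CordAlg

lemma cordAlgMap_ι_one :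
    cordAlgMap G m L (FreeAlgebra.ι _ 1) =
      1 + cordAlgMap G m L (algebraMap (LaurentPolynomial ℤ) _ (T 1)) := by
  rw [← map_one (cordAlgMap G m L), ← map_add, ← sub_eq_zero, ← map_sub]
  exact mk'_eq_zero_of_mem (.inl <| .inr rfl)

lemma cordAlgMap_ι_meridian_inv :
    cordAlgMap G m L (FreeAlgebra.ι _ m⁻¹) =
      1 + cordAlgMap G m L (algebraMap (LaurentPolynomial ℤ) _ (T (-1))) := by
  have h : cordAlgMap G m L (FreeAlgebra.ι _ (m⁻¹ * 1) -
      algebraMap (LaurentPolynomial ℤ) _ (T (-1)) * FreeAlgebra.ι _ 1) = 0 :=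
    mk'_eq_zero_of_mem (.inr <| .inr ⟨1, rfl⟩)
  rw [mul_one, map_sub, map_mul, sub_eq_zero, cordAlgMap_ι_one, mul_add, mul_one, ← map_mul,
    ← map_mul, ← T_add, neg_add_cancel, T_zero, map_one, map_one] at h
  rw [h, add_comm]

/-- The map `T(V) → A_Ng` sending `[x]` to `[x]`. -/
def freeToCordAlg : FreeAlgebra ℤ G →+* CordAlg G m L :=
  (FreeAlgebra.lift ℤ fun x ↦ cordAlgMap G m L (FreeAlgebra.ι _ x)).toRingHom

@[simp]
lemma freeToCordAlg_ι (x : G) :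
    freeToCordAlg G m L (FreeAlgebra.ι ℤ x) = cordAlgMap G m L (FreeAlgebra.ι _ x) :=
  FreeAlgebra.lift_ι_apply _ _

/-- The map `A → A_Ng` sending `[x]` to `[x]`. -/
def algAToCordAlg : AlgA G m L →+* CordAlg G m L :=
  liftSpan (freeToCordAlg G m L) <| by
    rintro z ((((⟨x, y, rfl⟩ | ⟨x, l, hl, rfl⟩) | ⟨x, l, hl, rfl⟩) | ⟨x, rfl⟩) | ⟨x, rfl⟩) <;>
    simp only [map_sub, map_add, map_mul, freeToCordAlg_ι] <;>
    simp only [← map_sub, ← map_add, ← map_mul] <;>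
    refine mk'_eq_zero_of_mem (.inl <| .inl ?_)
    · exact .inl <| .inl <| .inl <| .inl ⟨x, y, rfl⟩
    · exact .inl <| .inl <| .inl <| .inr ⟨x, l, hl, rfl⟩
    · exact .inl <| .inl <| .inr ⟨x, l, hl, rfl⟩
    · exact .inl <| .inr ⟨x, rfl⟩
    · exact .inr ⟨x, rfl⟩

lemma algAToCordAlg_algAMap (a : FreeAlgebra ℤ G) :
    algAToCordAlg G m L (algAMap G m L a) = freeToCordAlg G m L a :=
  rfl

end CordAlg

lemma cordAlgToAlgA_comp_algAToCordAlg :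
    (cordAlgToAlgA G m L).comp (algAToCordAlg G m L) = RingHom.id _ := by
  refine RingCon.Quotient.hom_ext (freeAlgebra_ringHom_ext (fun r ↦ by simp) fun x ↦ ?_)
  change cordAlgToAlgA G m L (algAToCordAlg G m L (algAMap G m L _)) = algAMap G m L _
  rw [algAToCordAlg_algAMap, freeToCordAlg_ι, cordAlgToAlgA_cordAlgMap, freeToAlgA_ι]

lemma algAToCordAlg_comp_laurentToAlgA :
    (algAToCordAlg G m L).comp (laurentToAlgA G m L) =
      (cordAlgMap G m L).comp (algebraMap _ _) := by
  apply laurentPolynomial_ringHom_ext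
  · rw [RingHom.comp_apply, laurentToAlgA_T_one, map_sub, map_one, algAToCordAlg_algAMap,
      freeToCordAlg_ι, cordAlgMap_ι_one, add_sub_cancel_left, RingHom.comp_apply]
  · rw [RingHom.comp_apply, laurentToAlgA_T_neg_one, map_sub, map_one, algAToCordAlg_algAMap,
      freeToCordAlg_ι, cordAlgMap_ι_meridian_inv, add_sub_cancel_left, RingHom.comp_apply]

lemma algAToCordAlg_comp_cordAlgToAlgA :
    (algAToCordAlg G m L).comp (cordAlgToAlgA G m L) = RingHom.id _ := by
  refine RingCon.Quotient.hom_ext (freeAlgebra_ringHom_ext (fun r ↦ ?_) fun x ↦ ?_)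
  · change algAToCordAlg G m L (cordAlgToAlgA G m L (cordAlgMap G m L _)) = cordAlgMap G m L _
    rw [cordAlgToAlgA_cordAlgMap, freeToAlgA_algebraMap]
    exact DFunLike.congr_fun (algAToCordAlg_comp_laurentToAlgA G m L) r
  · change algAToCordAlg G m L (cordAlgToAlgA G m L (cordAlgMap G m L _)) = cordAlgMap G m L _
    rw [cordAlgToAlgA_cordAlgMap, freeToAlgA_ι, algAToCordAlg_algAMap, freeToCordAlg_ι]

end CordAlgebra

/-- There is a ring isomorphism `f : A_Ng(G,m,L) ≃ A(G,m,L)` with `f([x]) = [x]`,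
`f(μ·1) = [1] - 1` and `f(μ⁻¹·1) = [m⁻¹] - 1`. -/
theorem cordAlg_equiv_algA (G : Type) [Group G] (m : G) (L : Subgroup G) :
    ∃ f : CordAlg G m L ≃+* AlgA G m L,
      (∀ x : G, f (cordAlgMap G m L (FreeAlgebra.ι _ x)) = algAMap G m L (FreeAlgebra.ι ℤ x)) ∧
      f (cordAlgMap G m L
          (algebraMap (LaurentPolynomial ℤ) (FreeAlgebra (LaurentPolynomial ℤ) G) (T 1)))
        = algAMap G m L (FreeAlgebra.ι ℤ (1 : G)) - 1 ∧
      f (cordAlgMap G m L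
          (algebraMap (LaurentPolynomial ℤ) (FreeAlgebra (LaurentPolynomial ℤ) G) (T (-1))))
        = algAMap G m L (FreeAlgebra.ι ℤ m⁻¹) - 1 := by
  refine ⟨RingEquiv.ofRingHom (CordAlgebra.cordAlgToAlgA G m L) (CordAlgebra.algAToCordAlg G m L)
    (CordAlgebra.cordAlgToAlgA_comp_algAToCordAlg G m L)
    (CordAlgebra.algAToCordAlg_comp_cordAlgToAlgA G m L), CordAlgebra.freeToAlgA_ι G m L, ?_, ?_⟩
  · exact (CordAlgebra.freeToAlgA_algebraMap G m L _).trans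
      (CordAlgebra.laurentToAlgA_T_one G m L)
  · exact (CordAlgebra.freeToAlgA_algebraMap G m L _).trans
      (CordAlgebra.laurentToAlgA_T_neg_one G m L)
end
end
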